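/- arXiv:2210.14923 — 4 statements merged into one kernel-verified Lean document; each statement's English description precedes it below -/
import Mathlib

section
/- Let D be a positive integer and let m, k be natural numbers with n = m + k. Then D/gcd(D,n) divides (D/gcd(D,m)) · (D/gcd(D,k)). -/
/-- `d / gcd d n` is the additive order of `n` modulo `d`: it divides exactly those `x` for which
`d` divides `x * n`. -/
theorem div_gcd_dvd_iff_dvd_mul {d : ℕ} (hd : 0 < d) (n x : ℕ) :
    d / Nat.gcd d n ∣ x ↔ d ∣ x * n := by
  have hg : 0 < Nat.gcd d n := Nat.gcd_pos_of_pos_left n hd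
  rw [← (Nat.coprime_div_gcd_div_gcd hg).dvd_mul_right, ← Nat.mul_dvd_mul_iff_right hg, mul_assoc,
    Nat.div_mul_cancel (Nat.gcd_dvd_left d n), Nat.div_mul_cancel (Nat.gcd_dvd_right d n)]

/-- For a positive integer `D` and natural numbers `m`, `k` with `n = m + k`,
`D/gcd(D,n)` divides `(D/gcd(D,m))·(D/gcd(D,k))`. (Here `gcd(D,0) = D`.) -/
theorem div_gcd_add_dvd_mul_div_gcd (D : ℕ) (hD : 0 < D) (m k : ℕ) :
    D / Nat.gcd D (m + k) ∣ (D / Nat.gcd D m) * (D / Nat.gcd D k) := by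
  rw [div_gcd_dvd_iff_dvd_mul hD, mul_add]
  exact dvd_add ((div_gcd_dvd_iff_dvd_mul hD m _).1 (dvd_mul_right _ _))
    ((div_gcd_dvd_iff_dvd_mul hD k _).1 (dvd_mul_left _ _))
end

section
/- Let t, b, c : ℕ → ℤ be integer sequences such that for every m ≥ 0: (i) t_m + 3c_m is even and 24/gcd(24,m) divides (t_m + 3c_m)/2; (ii) 24/gcd(24,m) divides c_m; (iii) 24/gcd(24,m) divides b_m. Then for every n ≥ 0, the sum Σ_{m=0}^{n} b_{n−m}(c_m − t_m) is even and 24/gcd(24,n) divides (1/2)·Σ_{m=0}^{n} b_{n−m}(c_m − t_m). -/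
/-- For `k > 0`, divisibility by `k / gcd(k, m)` means that `k` divides the multiple by `m`. -/
theorem natCast_div_gcd_dvd_iff {k : ℕ} (hk : 0 < k) (m : ℕ) (x : ℤ) :
    ((k / Nat.gcd k m : ℕ) : ℤ) ∣ x ↔ (k : ℤ) ∣ m * x := by
  have hg : 0 < Nat.gcd k m := Nat.gcd_pos_of_pos_left m hk
  rw [Int.natCast_dvd, Int.natCast_dvd, Int.natAbs_mul, Int.natAbs_natCast]
  constructor
  · intro h
    calc k = Nat.gcd k m * (k / Nat.gcd k m) := (Nat.mul_div_cancel' (Nat.gcd_dvd_left k m)).symm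
      _ ∣ m * x.natAbs := mul_dvd_mul (Nat.gcd_dvd_right k m) h
  · intro h
    refine (Nat.coprime_div_gcd_div_gcd hg).dvd_of_dvd_mul_left (Nat.dvd_of_mul_dvd_mul_left hg ?_)
    rwa [← mul_assoc, Nat.mul_div_cancel' (Nat.gcd_dvd_left k m),
      Nat.mul_div_cancel' (Nat.gcd_dvd_right k m)]

/-- The property `k / gcd(k, m) ∣ a m` of a sequence `a` is preserved under convolution. -/
theorem natCast_div_gcd_dvd_sum_mul {k : ℕ} (hk : 0 < k) {a b : ℕ → ℤ}
    (ha : ∀ m : ℕ, ((k / Nat.gcd k m : ℕ) : ℤ) ∣ a m)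
    (hb : ∀ m : ℕ, ((k / Nat.gcd k m : ℕ) : ℤ) ∣ b m) (n : ℕ) :
    ((k / Nat.gcd k n : ℕ) : ℤ) ∣ ∑ m ∈ Finset.range (n + 1), a (n - m) * b m := by
  refine Finset.dvd_sum fun m hm ↦ ?_
  have hmn : n - m + m = n := Nat.sub_add_cancel (Nat.lt_succ_iff.mp (Finset.mem_range.mp hm))
  have hab := dvd_add (((natCast_div_gcd_dvd_iff hk _ _).mp (ha (n - m))).mul_right (b m))
    (((natCast_div_gcd_dvd_iff hk _ _).mp (hb m)).mul_left (a (n - m)))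
  rw [natCast_div_gcd_dvd_iff hk]
  have hcast : (n : ℤ) = (n - m : ℕ) + m := by exact_mod_cast hmn.symm
  rwa [show (n : ℤ) * (a (n - m) * b m) =
    (n - m : ℕ) * a (n - m) * b m + a (n - m) * (m * b m) by rw [hcast]; ring]


/-- Arithmetic chain of Section 3.4: if for every `m ≥ 0` the integer `t_m + 3c_m` is even with
`24/gcd(24,m) ∣ (t_m + 3c_m)/2`, `24/gcd(24,m) ∣ c_m`, and `24/gcd(24,m) ∣ b_m`, then for every
`n ≥ 0` the sum `Σ_{m=0}^n b_{n-m}(c_m - t_m)` is even and `24/gcd(24,n)` divides its half. -/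
theorem discrete_torsion_divisibility_chain
    (t b c : ℕ → ℤ)
    (h1 : ∀ m : ℕ, (2 : ℤ) ∣ (t m + 3 * c m) ∧
      ((24 / Nat.gcd 24 m : ℕ) : ℤ) ∣ (t m + 3 * c m) / 2)
    (h2 : ∀ m : ℕ, ((24 / Nat.gcd 24 m : ℕ) : ℤ) ∣ c m)
    (h3 : ∀ m : ℕ, ((24 / Nat.gcd 24 m : ℕ) : ℤ) ∣ b m)
    (n : ℕ) :
    (2 : ℤ) ∣ (∑ m ∈ Finset.range (n + 1), b (n - m) * (c m - t m)) ∧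
      ((24 / Nat.gcd 24 n : ℕ) : ℤ) ∣
        (∑ m ∈ Finset.range (n + 1), b (n - m) * (c m - t m)) / 2 := by
  have hsum : ∑ m ∈ Finset.range (n + 1), b (n - m) * (c m - t m) =
      2 * ∑ m ∈ Finset.range (n + 1), b (n - m) * (2 * c m - (t m + 3 * c m) / 2) := by
    rw [Finset.mul_sum]
    refine Finset.sum_congr rfl fun m _ ↦ ?_
    linear_combination b (n - m) * Int.mul_ediv_cancel' (h1 m).1
  rw [hsum, Int.mul_ediv_cancel_left _ two_ne_zero]
  exact ⟨dvd_mul_right _ _, natCast_div_gcd_dvd_sum_mul (by norm_num) h3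
    (fun m ↦ dvd_sub ((h2 m).mul_left 2) (h1 m).2) n⟩
end

section
/- Let c : ℕ → ℤ be any function. Then in the formal power series ring ℚ[[p,q]], exp( Σ_{n≥1} Σ_{m≥0} ( Σ_{t | gcd(m,n), t≥1} t^{−1} c(mn/t²) ) p^n q^m ) = ∏_{n≥1} ∏_{m≥0} (1 − p^n q^m)^{−c(nm)}. -/
noncomputable instance : TopologicalSpace (MvPowerSeries (Fin 2) ℚ) :=
  inferInstanceAs (TopologicalSpace ((Fin 2 →₀ ℕ) → ℚ))

/-- The variable `p` in `ℚ[[p,q]]`. -/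
noncomputable def Pv : MvPowerSeries (Fin 2) ℚ := MvPowerSeries.X 0

/-- The variable `q` in `ℚ[[p,q]]`. -/
noncomputable def Qv : MvPowerSeries (Fin 2) ℚ := MvPowerSeries.X 1

/-- Formal exponential `exp S = Σ_{n≥0} S^n/n!` in `ℚ[[p,q]]`. -/
noncomputable def expS (S : MvPowerSeries (Fin 2) ℚ) : MvPowerSeries (Fin 2) ℚ :=
  ∑' n : ℕ, ((n.factorial : ℚ)⁻¹) • S ^ n

/-- `x ^ k` for an integer exponent `k`, via the inverse for negative `k`. -/
noncomputable def zpowF (x : MvPowerSeries (Fin 2) ℚ) (k : ℤ) : MvPowerSeries (Fin 2) ℚ :=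
  x ^ k.toNat * x⁻¹ ^ (-k).toNat

instance : IsTopologicalRing (MvPowerSeries (Fin 2) ℚ) :=
  MvPowerSeries.WithPiTopology.instIsTopologicalRing (Fin 2) ℚ

instance : T3Space (MvPowerSeries (Fin 2) ℚ) :=
  inferInstanceAs (T3Space ((Fin 2 →₀ ℕ) → ℚ))

namespace MvPowerSeries

theorem hasSum_iff_coeff {ι : Type*} {f : ι → MvPowerSeries (Fin 2) ℚ}
    {g : MvPowerSeries (Fin 2) ℚ} :
    HasSum f g ↔ ∀ d, HasSum (fun i ↦ coeff d (f i)) (coeff d g) :=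
  WithPiTopology.hasSum_iff_hasSum_coeff

theorem summable_of_coeff_finite {ι : Type*} {f : ι → MvPowerSeries (Fin 2) ℚ}
    (h : ∀ d, (Function.support fun i ↦ coeff d (f i)).Finite) : Summable f :=
  WithPiTopology.summable_iff_summable_coeff.2 fun d ↦ summable_of_hasFiniteSupport (h d)

theorem coeff_pow_eq_zero_of_degree_lt {S : MvPowerSeries (Fin 2) ℚ} (hS : constantCoeff S = 0)
    {d : Fin 2 →₀ ℕ} {n : ℕ} (h : d.degree < n) : coeff d (S ^ n) = 0 :=
  coeff_of_lt_order ((Nat.cast_lt.2 h).trans_le (le_order_pow_of_constantCoeff_eq_zero n hS))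

theorem coeff_pow_mul_pow_eq_zero_of_degree_lt {S T : MvPowerSeries (Fin 2) ℚ}
    (hS : constantCoeff S = 0) (hT : constantCoeff T = 0)
    {d : Fin 2 →₀ ℕ} {m n : ℕ} (h : d.degree < m + n) : coeff d (S ^ m * T ^ n) = 0 := by
  apply coeff_of_lt_order
  calc (d.degree : ℕ∞) < m + n := by exact_mod_cast h
    _ ≤ (S ^ m).order + (T ^ n).order := add_le_add
        (le_order_pow_of_constantCoeff_eq_zero m hS) (le_order_pow_of_constantCoeff_eq_zero n hT)
    _ ≤ _ := le_order_mul

theorem hasSum_subst {S : MvPowerSeries (Fin 2) ℚ} (hS : constantCoeff S = 0)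
    (f : PowerSeries ℚ) :
    HasSum (fun n ↦ PowerSeries.coeff n f • S ^ n) (f.subst S) := by
  rw [hasSum_iff_coeff]
  intro d
  have hsub := PowerSeries.HasSubst.of_constantCoeff_zero hS
  rw [PowerSeries.coeff_subst hsub]
  have hfin := PowerSeries.coeff_subst_finite hsub f d
  rw [finsum_eq_sum _ hfin]
  exact hasSum_sum_of_ne_finset_zero fun n hn ↦ by
    by_contra h
    exact hn ((Set.Finite.mem_toFinset hfin).2 h)

theorem hasSum_expS {S : MvPowerSeries (Fin 2) ℚ} (hS : constantCoeff S = 0) :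
    HasSum (fun n : ℕ ↦ ((n.factorial : ℚ)⁻¹) • S ^ n) (expS S) := by
  rw [expS]
  simpa using (hasSum_subst hS (PowerSeries.exp ℚ)).summable.hasSum

theorem expS_eq_subst {S : MvPowerSeries (Fin 2) ℚ} (hS : constantCoeff S = 0) :
    expS S = (PowerSeries.exp ℚ).subst S :=
  (hasSum_expS hS).unique (by simpa using hasSum_subst hS (PowerSeries.exp ℚ))

theorem coeff_expS {S : MvPowerSeries (Fin 2) ℚ} (hS : constantCoeff S = 0) (d : Fin 2 →₀ ℕ) :
    coeff d (expS S) =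
      ∑ n ∈ Finset.range (d.degree + 1), (n.factorial : ℚ)⁻¹ * coeff d (S ^ n) := by
  refine (hasSum_iff_coeff.1 (hasSum_expS hS) d).unique ?_
  refine hasSum_sum_of_ne_finset_zero fun n hn ↦ ?_
  rw [coeff_smul, coeff_pow_eq_zero_of_degree_lt hS (by simpa using hn), mul_zero]

theorem continuousOn_expS : ContinuousOn expS {S | constantCoeff S = 0} := by
  refine ContinuousOn.congr (f := fun S d ↦
    ∑ n ∈ Finset.range (d.degree + 1), (n.factorial : ℚ)⁻¹ * coeff d (S ^ n)) ?_
    fun S hS ↦ funext fun d ↦ coeff_expS hS d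
  refine (continuous_pi fun d ↦ continuous_finsetSum _ fun n _ ↦ ?_).continuousOn
  exact continuous_const.mul ((WithPiTopology.continuous_coeff ℚ d).comp (continuous_pow n))

theorem expS_zero : expS 0 = 1 := by
  rw [expS, tsum_eq_single 0 fun n hn ↦ by simp [hn]]
  simp

theorem expS_add {S T : MvPowerSeries (Fin 2) ℚ} (hS : constantCoeff S = 0)
    (hT : constantCoeff T = 0) : expS (S + T) = expS S * expS T := by
  have hsum : Summable fun x : ℕ × ℕ ↦
      (((x.1.factorial : ℚ)⁻¹) • S ^ x.1) * (((x.2.factorial : ℚ)⁻¹) • T ^ x.2) := by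
    refine summable_of_coeff_finite fun d ↦ Set.Finite.subset
      ((Finset.range (d.degree + 1) ×ˢ Finset.range (d.degree + 1)).finite_toSet) fun x hx ↦ ?_
    by_contra hx'
    refine hx ?_
    have : d.degree < x.1 + x.2 := by
      simp at hx'
      omega
    simp [coeff_pow_mul_pow_eq_zero_of_degree_lt hS hT this]
  rw [expS, expS, expS, (hasSum_expS hS).summable.tsum_mul_tsum_eq_tsum_sum_antidiagonal
    (hasSum_expS hT).summable hsum]
  refine tsum_congr fun n ↦ ?_
  rw [(Commute.all S T).add_pow', Finset.smul_sum]
  refine Finset.sum_congr rfl fun x hx ↦ ?_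
  rw [smul_mul_smul_comm, ← Nat.cast_smul_eq_nsmul ℚ, smul_smul]
  congr 1
  obtain rfl := Finset.HasAntidiagonal.mem_antidiagonal.1 hx
  rw [Nat.cast_add_choose]
  have h := Nat.factorial_ne_zero (x.1 + x.2)
  field_simp

theorem expS_sum {ι : Type*} (s : Finset ι) {f : ι → MvPowerSeries (Fin 2) ℚ}
    (hf : ∀ i, constantCoeff (f i) = 0) : expS (∑ i ∈ s, f i) = ∏ i ∈ s, expS (f i) := by
  classical
  induction s using Finset.induction_on with
  | empty => simp [expS_zero]
  | insert i s hi ih =>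
    rw [Finset.sum_insert hi, Finset.prod_insert hi, expS_add (hf i) (by simp [hf]), ih]

theorem hasProd_expS {ι : Type*} {f : ι → MvPowerSeries (Fin 2) ℚ} {S : MvPowerSeries (Fin 2) ℚ}
    (hf : ∀ i, constantCoeff (f i) = 0) (h : HasSum f S) :
    HasProd (fun i ↦ expS (f i)) (expS S) := by
  have hS : constantCoeff S = 0 := by
    have h0 := hasSum_iff_coeff.1 h 0
    simp only [coeff_zero_eq_constantCoeff_apply, hf] at h0
    exact h0.unique hasSum_zero
  have ht : Filter.Tendsto (fun s : Finset ι ↦ ∑ i ∈ s, f i) (SummationFilter.unconditional ι).filter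
      (nhdsWithin S {S | constantCoeff S = 0}) :=
    tendsto_nhdsWithin_iff.2 ⟨h, .of_forall fun s ↦ by simp [hf]⟩
  refine ((continuousOn_expS S hS).tendsto.comp ht).congr fun s ↦ ?_
  exact expS_sum s hf

end MvPowerSeries

namespace PowerSeries

/-- The power series `-log (1 - X) = ∑_{t ≥ 1} X ^ t / t`. -/
noncomputable def negLogOneSub : PowerSeries ℚ := mk fun t ↦ (t : ℚ)⁻¹

theorem constantCoeff_negLogOneSub : constantCoeff negLogOneSub = 0 := by
  simp [negLogOneSub, ← coeff_zero_eq_constantCoeff_apply]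

theorem derivative_negLogOneSub : derivative ℚ negLogOneSub = mk 1 := by
  ext n
  rw [coeff_derivative, negLogOneSub, coeff_mk, coeff_mk]
  push_cast
  exact inv_mul_cancel₀ (by positivity)

theorem exp_subst_negLogOneSub_mul : (exp ℚ).subst negLogOneSub * (1 - X) = 1 := by
  have hs := HasSubst.of_constantCoeff_zero' constantCoeff_negLogOneSub
  apply derivative.ext
  · rw [Derivation.leibniz, derivative_subst hs, derivative_exp, derivative_negLogOneSub]
    have := mk_one_mul_one_sub_eq_one ℚ
    simp only [smul_eq_mul, map_sub, derivative_X, Derivation.map_one_eq_zero]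
    linear_combination subst negLogOneSub (exp ℚ) * this
  · have : constantCoeff ((exp ℚ).subst negLogOneSub) = 1 := by
      refine (constantCoeff_subst hs _).trans ?_
      rw [finsum_eq_single _ 0]
      · simp
      · intro n hn
        have := constantCoeff_negLogOneSub
        rw [map_pow]
        erw [this]
        simp [hn]
    simp [this]

end PowerSeries

namespace MvPowerSeries

theorem constantCoeff_subst_negLogOneSub {x : MvPowerSeries (Fin 2) ℚ}
    (hx : constantCoeff x = 0) : constantCoeff (PowerSeries.negLogOneSub.subst x) = 0 :=
  PowerSeries.constantCoeff_subst_eq_zero hx _ PowerSeries.constantCoeff_negLogOneSub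

theorem expS_subst_negLogOneSub {x : MvPowerSeries (Fin 2) ℚ} (hx : constantCoeff x = 0) :
    expS (PowerSeries.negLogOneSub.subst x) = (1 - x)⁻¹ := by
  have hs := PowerSeries.HasSubst.of_constantCoeff_zero hx
  have hl := PowerSeries.HasSubst.of_constantCoeff_zero' PowerSeries.constantCoeff_negLogOneSub
  rw [MvPowerSeries.eq_inv_iff_mul_eq_one (by simp [hx]),
    expS_eq_subst (constantCoeff_subst_negLogOneSub hx),
    ← PowerSeries.subst_comp_subst_apply hl hs]
  have h := congrArg (PowerSeries.substAlgHom hs) PowerSeries.exp_subst_negLogOneSub_mul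
  rwa [map_mul, map_sub, map_one, PowerSeries.substAlgHom_X, PowerSeries.coe_substAlgHom] at h

theorem expS_natCast_smul {S : MvPowerSeries (Fin 2) ℚ} (hS : constantCoeff S = 0) (k : ℕ) :
    expS ((k : ℚ) • S) = expS S ^ k := by
  induction k with
  | zero => simp [expS_zero]
  | succ k ih =>
    rw [Nat.cast_succ, add_smul, one_smul, expS_add (by simp [hS]) hS, ih, pow_succ]

theorem expS_neg {S : MvPowerSeries (Fin 2) ℚ} (hS : constantCoeff S = 0) :
    expS (-S) * expS S = 1 := by
  rw [← expS_add (by simp [hS]) hS, neg_add_cancel, expS_zero]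

theorem expS_intCast_smul_subst_negLogOneSub {x : MvPowerSeries (Fin 2) ℚ}
    (hx : constantCoeff x = 0) (k : ℤ) :
    expS ((k : ℚ) • PowerSeries.negLogOneSub.subst x) = zpowF (1 - x) (-k) := by
  have hL := constantCoeff_subst_negLogOneSub hx
  have h1 : (1 - x) * (1 - x)⁻¹ = 1 := MvPowerSeries.mul_inv_cancel _ (by simp [hx])
  obtain ⟨n, rfl | rfl⟩ := k.eq_nat_or_neg
  · simp [zpowF, expS_natCast_smul hL, expS_subst_negLogOneSub hx]
  · have hneg : expS (-PowerSeries.negLogOneSub.subst x) = 1 - x := by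
      have h := expS_neg hL
      rw [expS_subst_negLogOneSub hx] at h
      linear_combination (1 - x) * h - expS (-PowerSeries.negLogOneSub.subst x) * h1
    have : ((-(n : ℤ) : ℤ) : ℚ) • PowerSeries.negLogOneSub.subst x
        = (n : ℚ) • -PowerSeries.negLogOneSub.subst x := by simp
    rw [this, expS_natCast_smul (by simp [hL]), hneg]
    simp [zpowF]

end MvPowerSeries

namespace MvPowerSeries

theorem constantCoeff_Pv_pow_mul_Qv_pow (n m : ℕ) :
    constantCoeff (Pv ^ (n + 1) * Qv ^ m) = 0 := by
  simp [Pv]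

theorem coeff_Pv_pow_mul_Qv_pow (n m : ℕ) (d : Fin 2 →₀ ℕ) :
    coeff d (Pv ^ n * Qv ^ m) = if d 0 = n ∧ d 1 = m then 1 else 0 := by
  classical
  rw [Pv, Qv, X_pow_eq, X_pow_eq, monomial_mul_monomial, coeff_monomial, one_mul]
  refine if_congr ?_ rfl rfl
  simp [Finsupp.ext_iff, Fin.forall_fin_two]

/-- The series whose coefficient at `p ^ n * q ^ m` is `∑_{t ∣ gcd(m, n)} t⁻¹ C(n / t - 1, m / t)`
when `n ≥ 1`, and `0` when `n = 0`. -/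
noncomputable def heckeSeries (C : ℕ → ℕ → ℚ) : MvPowerSeries (Fin 2) ℚ := fun d ↦
  if d 0 = 0 then 0
  else ∑ t ∈ (Nat.gcd (d 1) (d 0)).divisors, (t : ℚ)⁻¹ * C (d 0 / t - 1) (d 1 / t)

theorem coeff_heckeSeries (C : ℕ → ℕ → ℚ) (d : Fin 2 →₀ ℕ) :
    coeff d (heckeSeries C) = if d 0 = 0 then 0
      else ∑ t ∈ (Nat.gcd (d 1) (d 0)).divisors, (t : ℚ)⁻¹ * C (d 0 / t - 1) (d 1 / t) :=
  rfl

theorem coeff_heckeSeries_term (C : ℕ → ℕ → ℚ) (n m t : ℕ) (d : Fin 2 →₀ ℕ) :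
    coeff d (C n m • (PowerSeries.coeff t PowerSeries.negLogOneSub • (Pv ^ (n + 1) * Qv ^ m) ^ t))
      = if d 0 = (n + 1) * t ∧ d 1 = m * t then (t : ℚ)⁻¹ * C n m else 0 := by
  rw [mul_pow, ← pow_mul, ← pow_mul, coeff_smul, coeff_smul, coeff_Pv_pow_mul_Qv_pow,
    PowerSeries.negLogOneSub, PowerSeries.coeff_mk]
  split_ifs <;> simp [mul_comm]

theorem hasSum_heckeSeries_terms (C : ℕ → ℕ → ℚ) :
    HasSum (fun x : (ℕ × ℕ) × ℕ ↦ C x.1.1 x.1.2 •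
      (PowerSeries.coeff x.2 PowerSeries.negLogOneSub • (Pv ^ (x.1.1 + 1) * Qv ^ x.1.2) ^ x.2))
      (heckeSeries C) := by
  rw [hasSum_iff_coeff]
  intro d
  simp only [coeff_heckeSeries_term, coeff_heckeSeries]
  by_cases hd : d 0 = 0
  · rw [if_pos hd]
    convert! hasSum_zero with x
    split_ifs with h
    · have h0 : x.2 = 0 := by
        have := h.1
        rw [hd, eq_comm, mul_eq_zero] at this
        exact this.resolve_left (Nat.succ_ne_zero _)
      simp [h0]
    · rfl
  · rw [if_neg hd]
    have hgcd : Nat.gcd (d 1) (d 0) ≠ 0 := by simp [hd]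
    let F : ℕ → (ℕ × ℕ) × ℕ := fun t ↦ ((d 0 / t - 1, d 1 / t), t)
    have hF : Function.Injective F := fun a b h ↦ congrArg Prod.snd h
    have key : HasSum (fun x : (ℕ × ℕ) × ℕ ↦
        if d 0 = (x.1.1 + 1) * x.2 ∧ d 1 = x.1.2 * x.2 then (x.2 : ℚ)⁻¹ * C x.1.1 x.1.2 else 0)
        (∑ x ∈ (Nat.gcd (d 1) (d 0)).divisors.map ⟨F, hF⟩,
          if d 0 = (x.1.1 + 1) * x.2 ∧ d 1 = x.1.2 * x.2 then (x.2 : ℚ)⁻¹ * C x.1.1 x.1.2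
          else 0) := by
      refine hasSum_sum_of_ne_finset_zero ?_
      rintro ⟨⟨n, m⟩, t⟩ hx
      refine if_neg fun h ↦ hx ?_
      obtain ⟨h0, h1⟩ : d 0 = (n + 1) * t ∧ d 1 = m * t := h
      have ht : 0 < t := by
        rcases Nat.eq_zero_or_pos t with rfl | ht
        · simp_all
        · exact ht
      refine Finset.mem_map.2 ⟨t, Nat.mem_divisors.2 ⟨Nat.dvd_gcd ⟨m, ?_⟩ ⟨n + 1, ?_⟩, hgcd⟩, ?_⟩
      · rw [h1, mul_comm]
      · rw [h0, mul_comm]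
      · simp [F, h0, h1, Nat.mul_div_cancel _ ht]
    convert! key using 1
    rw [Finset.sum_map]
    refine Finset.sum_congr rfl fun t ht ↦ ?_
    have htg := Nat.dvd_of_mem_divisors ht
    obtain ⟨a, ha⟩ := htg.trans (Nat.gcd_dvd_right _ _)
    obtain ⟨b, hb⟩ := htg.trans (Nat.gcd_dvd_left _ _)
    have ht0 : 0 < t := Nat.pos_of_mem_divisors ht
    have ha0 : a ≠ 0 := by rintro rfl; simp_all
    rw [if_pos]
    · rfl
    · simp only [F, Function.Embedding.coeFn_mk, ha, hb, Nat.mul_div_cancel_left _ ht0]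
      rw [Nat.sub_add_cancel (by omega), mul_comm a, mul_comm b]
      exact ⟨rfl, rfl⟩

theorem hasSum_smul_subst_negLogOneSub (C : ℕ → ℕ → ℚ) :
    HasSum (fun x : ℕ × ℕ ↦
      C x.1 x.2 • PowerSeries.negLogOneSub.subst (Pv ^ (x.1 + 1) * Qv ^ x.2)) (heckeSeries C) := by
  refine (hasSum_heckeSeries_terms C).prod_fiberwise fun x ↦ ?_
  have h := hasSum_subst (constantCoeff_Pv_pow_mul_Qv_pow x.1 x.2) PowerSeries.negLogOneSub
  rw [hasSum_iff_coeff] at h ⊢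
  exact fun d ↦ (h d).mul_left (C x.1 x.2)

theorem summable_smul_subst_negLogOneSub (C : ℕ → ℕ → ℚ) (n : ℕ) :
    Summable fun m ↦ C n m • PowerSeries.negLogOneSub.subst (Pv ^ (n + 1) * Qv ^ m) := by
  have h := hasSum_smul_subst_negLogOneSub fun i j ↦ if i = n then C i j else 0
  rw [← (Prod.mk_right_injective n).hasSum_iff] at h
  · simpa [Function.comp_def] using h.summable
  · rintro ⟨i, j⟩ hij
    have : i ≠ n := fun h ↦ hij ⟨j, by rw [h]⟩
    simp [this]

theorem hasSum_of_eq_of_forall_ne {f : ℕ → ℚ} {a : ℚ} (n : ℕ) (hn : f n = a)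
    (h : ∀ m, m ≠ n → f m = 0) : HasSum f a :=
  hn ▸ hasSum_single n h

/-- The part of a series in `ℚ[[p,q]]` of degree `n` in `p`. -/
noncomputable def pPart (S : MvPowerSeries (Fin 2) ℚ) (n : ℕ) : MvPowerSeries (Fin 2) ℚ :=
  fun d ↦ if d 0 = n then coeff d S else 0

theorem coeff_pPart (S : MvPowerSeries (Fin 2) ℚ) (n : ℕ) (d : Fin 2 →₀ ℕ) :
    coeff d (pPart S n) = if d 0 = n then coeff d S else 0 :=
  rfl

theorem hasSum_pPart (S : MvPowerSeries (Fin 2) ℚ) (n : ℕ) :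
    HasSum (fun m : ℕ ↦ coeff (Finsupp.single 0 n + Finsupp.single 1 m) S • (Pv ^ n * Qv ^ m))
      (pPart S n) := by
  rw [hasSum_iff_coeff]
  intro d
  refine hasSum_of_eq_of_forall_ne (d 1) ?_ ?_
  · simp only [coeff_smul, coeff_Pv_pow_mul_Qv_pow, coeff_pPart]
    by_cases hd : d 0 = n
    · have : Finsupp.single 0 n + Finsupp.single 1 (d 1) = d := by
        simp [Finsupp.ext_iff, Fin.forall_fin_two, hd]
      simp [hd, this]
    · simp [hd]
  · intro m hm
    simp [coeff_Pv_pow_mul_Qv_pow, hm.symm]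

theorem tsum_tsum_coeff_smul {S : MvPowerSeries (Fin 2) ℚ} (hS : ∀ d, d 0 = 0 → coeff d S = 0) :
    ∑' n : ℕ, ∑' m : ℕ, coeff (Finsupp.single 0 (n + 1) + Finsupp.single 1 m) S •
      (Pv ^ (n + 1) * Qv ^ m) = S := by
  simp_rw [fun n ↦ (hasSum_pPart S (n + 1)).tsum_eq]
  refine HasSum.tsum_eq ?_
  rw [hasSum_iff_coeff]
  intro d
  simp only [coeff_pPart]
  by_cases hd : d 0 = 0
  · simp [hd, hS d hd]
  · refine hasSum_of_eq_of_forall_ne (d 0 - 1) ?_ ?_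
    · rw [if_pos (by omega)]
    · exact fun n hn ↦ if_neg (by omega)

end MvPowerSeries

open MvPowerSeries in
theorem tsum_tsum_hecke (c : ℕ → ℤ) :
    ∑' n : ℕ, ∑' m : ℕ,
        (∑ t ∈ (Nat.gcd m (n + 1)).divisors,
          (t : ℚ)⁻¹ * (c (m * (n + 1) / t ^ 2) : ℚ)) • (Pv ^ (n + 1) * Qv ^ m) =
      heckeSeries fun n m ↦ (c ((n + 1) * m) : ℚ) := by
  rw [← tsum_tsum_coeff_smul (S := heckeSeries _) fun d hd ↦ by
    rw [coeff_heckeSeries, if_pos hd]]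
  refine tsum_congr fun n ↦ tsum_congr fun m ↦ ?_
  congr 1
  simp only [coeff_heckeSeries, Finsupp.add_apply, Finsupp.single_apply]
  simp only [Fin.isValue, one_ne_zero, zero_ne_one, if_true, if_false, add_zero, zero_add,
    Nat.add_eq_zero_iff, and_false]
  refine Finset.sum_congr rfl fun t ht ↦ ?_
  have htg := Nat.dvd_of_mem_divisors ht
  obtain ⟨a, ha⟩ := htg.trans (Nat.gcd_dvd_right _ _)
  obtain ⟨b, rfl⟩ := htg.trans (Nat.gcd_dvd_left _ _)
  have ht0 : 0 < t := Nat.pos_of_mem_divisors ht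
  have ha0 : a ≠ 0 := by rintro rfl; simp at ha
  rw [ha, Nat.mul_div_cancel_left _ ht0, Nat.mul_div_cancel_left _ ht0,
    Nat.sub_add_cancel (by omega), show t * b * (t * a) = t ^ 2 * (a * b) by ring,
    Nat.mul_div_cancel_left _ (by positivity)]

/-- The exp–log form of the DMVV/Bantay formula: for any `c : ℕ → ℤ`, in `ℚ[[p,q]]`,
`exp(Σ_{n≥1} Σ_{m≥0} (Σ_{t | gcd(m,n)} t⁻¹ c(mn/t²)) p^n q^m) = ∏_{n≥1}∏_{m≥0}(1-p^n q^m)^{-c(nm)}`. -/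
theorem dmvv_exp_hecke (c : ℕ → ℤ) :
    expS (∑' n : ℕ, ∑' m : ℕ,
        (∑ t ∈ (Nat.gcd m (n + 1)).divisors,
          (t : ℚ)⁻¹ * (c (m * (n + 1) / t ^ 2) : ℚ)) • (Pv ^ (n + 1) * Qv ^ m)) =
      ∏' n : ℕ, ∏' m : ℕ, zpowF (1 - Pv ^ (n + 1) * Qv ^ m) (-c ((n + 1) * m)) := by
  rw [tsum_tsum_hecke]
  set C : ℕ → ℕ → ℚ := fun n m ↦ (c ((n + 1) * m) : ℚ)
  have h0 (n m : ℕ) : MvPowerSeries.constantCoeff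
      (C n m • PowerSeries.negLogOneSub.subst (Pv ^ (n + 1) * Qv ^ m)) = 0 := by
    simp [MvPowerSeries.constantCoeff_subst_negLogOneSub
      (MvPowerSeries.constantCoeff_Pv_pow_mul_Qv_pow n m)]
  have hexp (n m : ℕ) := MvPowerSeries.expS_intCast_smul_subst_negLogOneSub
    (MvPowerSeries.constantCoeff_Pv_pow_mul_Qv_pow n m) (c ((n + 1) * m))
  have hprod := MvPowerSeries.hasProd_expS (fun x : ℕ × ℕ ↦ h0 x.1 x.2)
    (MvPowerSeries.hasSum_smul_subst_negLogOneSub C)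
  have hinner (n : ℕ) := MvPowerSeries.hasProd_expS (h0 n)
    (MvPowerSeries.summable_smul_subst_negLogOneSub C n).hasSum
  rw [← (hprod.prod_fiberwise hinner).tprod_eq]
  refine tprod_congr fun n ↦ ?_
  rw [← (hinner n).tprod_eq]
  exact tprod_congr fun m ↦ hexp n m
end

section
/- Let c : ℕ → ℤ be any function. Then in the formal power series ring ℚ[[p,q]], log( ∏_{n≥1} ∏_{m≥0} (1 + (−p)^n q^m)^{−c(nm)} ) = Σ_{n≥1} Σ_{m≥0} ( Σ_{t | gcd(m,n), t≥1} (−1)^{n+t} t^{−1} c(mn/t²) ) p^n q^m. -/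
/-- Formal logarithm `log F = Σ_{n≥1} (-1)^{n+1} (F-1)^n / n` in `ℚ[[p,q]]`. -/
noncomputable def logS (F : MvPowerSeries (Fin 2) ℚ) : MvPowerSeries (Fin 2) ℚ :=
  ∑' n : ℕ, ((-1 : ℚ) ^ n * ((n + 1 : ℕ) : ℚ)⁻¹) • (F - 1) ^ (n + 1)

namespace MvPowerSeries

section IsLog

variable {σ k : Type*} [Field k]

/-- `L` is the logarithm of `F`: both are normalised at the origin, and `dL = dF / F`. -/
structure IsLog (F L : MvPowerSeries σ k) : Prop where
  constantCoeff_left : constantCoeff F = 1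
  constantCoeff_right : constantCoeff L = 0
  mul_pderiv (i : σ) : F * pderiv k i L = pderiv k i F

open scoped WithPiTopology

theorem continuous_pderiv [TopologicalSpace k] [IsTopologicalRing k] (i : σ) :
    Continuous (pderiv k i : MvPowerSeries σ k → MvPowerSeries σ k) :=
  continuous_pi fun d =>
    (WithPiTopology.continuous_coeff k (d + Finsupp.single i 1)).mul continuous_const

theorem summable_smul_pow_succ [TopologicalSpace k] (a : ℕ → k)
    {u : MvPowerSeries σ k} (hu : constantCoeff u = 0) : Summable fun n => a n • u ^ (n + 1) := by
  refine WithPiTopology.summable_of_tendsto_order_atTop_nhds_top ?_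
  refine ENat.tendsto_nhds_top_iff_natCast_lt.mpr fun n =>
    Filter.eventually_atTop.mpr ⟨n, fun m hm => ?_⟩
  refine lt_of_lt_of_le ?_
    ((le_order_pow_of_constantCoeff_eq_zero (m + 1) hu).trans le_order_smul)
  exact_mod_cast Nat.lt_succ_of_le hm

namespace IsLog

variable {F G L M : MvPowerSeries σ k}

theorem unique [CharZero k] (hL : IsLog F L) (hM : IsLog F M) : L = M := by
  have hF : F ≠ 0 := by
    rintro rfl
    simpa using hL.constantCoeff_left
  refine pderiv.ext (fun i => mul_left_cancel₀ hF ?_) ?_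
  · rw [hL.mul_pderiv, hM.mul_pderiv]
  · rw [hL.constantCoeff_right, hM.constantCoeff_right]

theorem one : IsLog (1 : MvPowerSeries σ k) 0 :=
  ⟨by simp, by simp, fun i => by simp⟩

theorem mul (hF : IsLog F L) (hG : IsLog G M) : IsLog (F * G) (L + M) where
  constantCoeff_left := by simp [hF.constantCoeff_left, hG.constantCoeff_left]
  constantCoeff_right := by simp [hF.constantCoeff_right, hG.constantCoeff_right]
  mul_pderiv i := by
    rw [map_add, Derivation.leibniz, smul_eq_mul, smul_eq_mul, ← hF.mul_pderiv, ← hG.mul_pderiv]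
    ring

theorem inv (hF : IsLog F L) : IsLog F⁻¹ (-L) where
  constantCoeff_left := by simp [hF.constantCoeff_left]
  constantCoeff_right := by simp [hF.constantCoeff_right]
  mul_pderiv i := by
    have h : F⁻¹ * F = 1 := MvPowerSeries.inv_mul_cancel F (by simp [hF.constantCoeff_left])
    rw [map_neg, pderiv_inv', ← hF.mul_pderiv]
    linear_combination (F⁻¹ * pderiv k i L) * h

theorem pow (hF : IsLog F L) (n : ℕ) : IsLog (F ^ n) (n • L) := by
  induction n with
  | zero => simpa using one
  | succ n ih => rw [pow_succ, succ_nsmul]; exact ih.mul hF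

theorem prod {ι : Type*} {f g : ι → MvPowerSeries σ k} (h : ∀ i, IsLog (f i) (g i))
    (s : Finset ι) : IsLog (∏ i ∈ s, f i) (∑ i ∈ s, g i) := by
  classical
  induction s using Finset.induction_on with
  | empty => simpa using one
  | insert a s ha ih => simpa [ha] using (h a).mul ih

variable [TopologicalSpace k] [IsTopologicalRing k]

theorem hasProd [T2Space k] {ι : Type*} {f g : ι → MvPowerSeries σ k}
    (h : ∀ i, IsLog (f i) (g i)) (hF : HasProd f F) (hL : HasSum g L) : IsLog F L where
  constantCoeff_left := by
    refine tendsto_nhds_unique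
      (((WithPiTopology.continuous_constantCoeff k).tendsto F).comp hF) ?_
    simpa only [Function.comp_def, (prod h _).constantCoeff_left] using tendsto_const_nhds
  constantCoeff_right := by
    refine tendsto_nhds_unique
      (((WithPiTopology.continuous_constantCoeff k).tendsto L).comp hL) ?_
    simpa only [Function.comp_def, (prod h _).constantCoeff_right] using tendsto_const_nhds
  mul_pderiv i := by
    have h₁ := Filter.Tendsto.mul hF (((continuous_pderiv i).tendsto L).comp hL)
    refine tendsto_nhds_unique h₁ ?_
    simpa only [Function.comp_def, (prod h _).mul_pderiv] using
      ((continuous_pderiv i).tendsto F).comp hF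

theorem one_add_tsum [CharZero k] [T2Space k] {u : MvPowerSeries σ k} (hu : constantCoeff u = 0) :
    IsLog (1 + u) (∑' n : ℕ, ((-1 : k) ^ n * ((n + 1 : ℕ) : k)⁻¹) • u ^ (n + 1)) where
  constantCoeff_left := by simp [hu]
  constantCoeff_right := by
    have h := (summable_smul_pow_succ (fun n => (-1 : k) ^ n * ((n + 1 : ℕ) : k)⁻¹) hu).hasSum.map
      (constantCoeff (σ := σ) (R := k)) (WithPiTopology.continuous_constantCoeff k)
    rw [← h.tsum_eq]
    simp [hu]
  mul_pderiv i := by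
    have h := (summable_smul_pow_succ (fun n => (-1 : k) ^ n * ((n + 1 : ℕ) : k)⁻¹) hu).hasSum.map
      (pderiv k i) (continuous_pderiv i)
    have hu' : constantCoeff (-u) = 0 := by simp [hu]
    have hg := (WithPiTopology.summable_pow_of_constantCoeff_eq_zero hu').hasSum.mul_right
      (pderiv k i u)
    have hfun : (pderiv k i) ∘ (fun n => ((-1 : k) ^ n * ((n + 1 : ℕ) : k)⁻¹) • u ^ (n + 1)) =
        fun n => (-u) ^ n * pderiv k i u := by
      funext n
      have hn : ((n + 1 : ℕ) : k) ≠ 0 := by exact_mod_cast n.succ_ne_zero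
      have hC : ((n + 1 : ℕ) : MvPowerSeries σ k) = C ((n + 1 : ℕ) : k) := by simp
      rw [Function.comp_apply, Derivation.map_smul, pderiv_pow, hC, Nat.add_sub_cancel,
        ← smul_eq_C_mul, smul_mul_assoc, smul_smul, mul_assoc, inv_mul_cancel₀ hn, mul_one,
        neg_pow u, smul_eq_C_mul]
      simp [mul_assoc]
    rw [hfun] at h
    have hgeom := WithPiTopology.one_sub_mul_tsum_pow_of_constantCoeff_eq_zero hu'
    rw [h.unique hg, ← mul_assoc, ← sub_neg_eq_add, hgeom]
    simp

end IsLog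

end IsLog

section Multipliable

variable {σ R : Type*} [CommRing R]

open scoped WithPiTopology

theorem multipliable_of_natCast_le_order_sub_one [TopologicalSpace R]
    {f : ℕ → MvPowerSeries σ R}
    (hf : ∀ n : ℕ, (n : ℕ∞) ≤ (f n - 1).order) : Multipliable f := by
  have h : Multipliable fun n => 1 + (f n - 1) := by
    refine WithPiTopology.multipliable_one_add_of_tendsto_order_atTop_nhds_top ?_
    refine ENat.tendsto_nhds_top_iff_natCast_lt.mpr fun n =>
      Filter.eventually_atTop.mpr ⟨n + 1, fun m hm => lt_of_lt_of_le ?_ (hf m)⟩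
    exact_mod_cast hm
  simpa using h

theorem le_order_mul_sub_one {N : ℕ∞} {f g : MvPowerSeries σ R}
    (hf : N ≤ (f - 1).order) (hg : N ≤ (g - 1).order) : N ≤ (f * g - 1).order := by
  have h : f * g - 1 = (f - 1) * g + (g - 1) := by ring
  rw [h]
  refine le_trans (le_min ?_ hg) min_order_le_add
  exact (hf.trans le_self_add).trans le_order_mul

theorem le_order_sub_one_of_hasProd [TopologicalSpace R] [T2Space R] [IsTopologicalRing R]
    {ι : Type*} {N : ℕ∞} {f : ι → MvPowerSeries σ R} {F : MvPowerSeries σ R}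
    (hf : ∀ i, N ≤ (f i - 1).order) (hF : HasProd f F) : N ≤ (F - 1).order := by
  have hs (s : Finset ι) : N ≤ (∏ i ∈ s, f i - 1).order :=
    Finset.prod_induction f (fun g => N ≤ (g - 1).order) (fun _ _ => le_order_mul_sub_one)
      (by simp) (fun i _ => hf i)
  refine le_order fun d hd => ?_
  refine tendsto_nhds_unique (((WithPiTopology.continuous_coeff R d).tendsto _).comp
    (Filter.Tendsto.sub_const hF 1)) ?_
  have h0 (s : Finset ι) : coeff d (∏ i ∈ s, f i - 1) = 0 :=
    coeff_of_lt_order (lt_of_lt_of_le hd (hs s))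
  simpa only [Function.comp_def, h0] using tendsto_const_nhds

end Multipliable

end MvPowerSeries

open MvPowerSeries

theorem MvPowerSeries.IsLog.zpowF {F L : MvPowerSeries (Fin 2) ℚ} (h : IsLog F L) (n : ℤ) :
    IsLog (zpowF F n) (n • L) := by
  have hL : n • L = n.toNat • L + (-n).toNat • -L := by
    rw [← natCast_zsmul, ← natCast_zsmul, smul_neg, ← sub_eq_add_neg, ← sub_smul]
    congr 1
    omega
  rw [hL]
  exact (h.pow n.toNat).mul (h.inv.pow (-n).toNat)

theorem MvPowerSeries.isLog_logS {F : MvPowerSeries (Fin 2) ℚ} (hF : constantCoeff F = 1) :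
    IsLog F (logS F) := by
  have h := IsLog.one_add_tsum (u := F - 1) (by simp [hF])
  rw [add_sub_cancel] at h
  exact h

theorem sub_one_dvd_zpowF_sub_one {x : MvPowerSeries (Fin 2) ℚ} (hx : constantCoeff x = 1) (n : ℤ) :
    x - 1 ∣ zpowF x n - 1 := by
  have hinv : x⁻¹ * x = 1 := MvPowerSeries.inv_mul_cancel x (by simp [hx])
  have h₁ : x - 1 ∣ x ^ n.toNat - 1 := sub_one_dvd_pow_sub_one _ _
  have h₂ : x - 1 ∣ x⁻¹ ^ (-n).toNat - 1 := by
    refine dvd_trans ⟨-x⁻¹, ?_⟩ (sub_one_dvd_pow_sub_one x⁻¹ _)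
    linear_combination hinv
  have h : zpowF x n - 1 =
      (x ^ n.toNat - 1) * x⁻¹ ^ (-n).toNat + (x⁻¹ ^ (-n).toNat - 1) := by
    rw [zpowF]; ring
  rw [h]
  exact dvd_add (h₁.mul_right _) h₂

theorem MvPowerSeries.coeff_Pv_pow_mul_Qv_pow_s12 (d : Fin 2 →₀ ℕ) (a b : ℕ) :
    coeff d (Pv ^ a * Qv ^ b) = if d 0 = a ∧ d 1 = b then 1 else 0 := by
  classical
  rw [Pv, Qv, X_pow_eq, X_pow_eq, monomial_mul_monomial, mul_one, coeff_monomial]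
  refine if_congr ?_ rfl rfl
  simp [Finsupp.ext_iff, Fin.forall_fin_two]

theorem MvPowerSeries.natCast_le_order_neg_Pv_pow_mul_Qv_pow (a b : ℕ) :
    ((a + b : ℕ) : ℕ∞) ≤ ((-Pv) ^ a * Qv ^ b).order := by
  have h : ((-Pv) ^ a * Qv ^ b) = (-1 : ℚ) ^ a • (Pv ^ a * Qv ^ b) := by
    rw [neg_pow, smul_eq_C_mul]; simp [mul_assoc]
  rw [h]
  refine le_trans (nat_le_order fun d hd => ?_) le_order_smul
  rw [coeff_Pv_pow_mul_Qv_pow_s12, if_neg]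
  rintro ⟨rfl, rfl⟩
  rw [Finsupp.degree_eq_sum, Fin.sum_univ_two] at hd
  exact lt_irrefl _ hd

theorem exists_hasSum_smul_Pv_pow_mul_Qv_pow (A : ℕ → ℕ → ℚ) :
    ∃ (G : ℕ → MvPowerSeries (Fin 2) ℚ) (R : MvPowerSeries (Fin 2) ℚ),
      (∀ n, HasSum (fun m => A n m • (Pv ^ (n + 1) * Qv ^ m)) (G n)) ∧ HasSum G R ∧
      ∀ d, coeff d R = if d 0 = 0 then 0 else A (d 0 - 1) (d 1) := by
  refine ⟨fun n d => if d 0 = n + 1 then A n (d 1) else 0,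
    fun d => if d 0 = 0 then 0 else A (d 0 - 1) (d 1), fun n => ?_, ?_, fun d => rfl⟩
  · refine WithPiTopology.hasSum_iff_hasSum_coeff.mpr fun d => ?_
    change HasSum _ (if d 0 = n + 1 then A n (d 1) else 0)
    convert hasSum_single (d 1) ?_ using 1
    · simp [coeff_Pv_pow_mul_Qv_pow_s12]
    · intro m hm
      simp [coeff_Pv_pow_mul_Qv_pow_s12, hm.symm]
  · refine WithPiTopology.hasSum_iff_hasSum_coeff.mpr fun d => ?_
    change HasSum (fun n => if d 0 = n + 1 then A n (d 1) else 0)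
      (if d 0 = 0 then 0 else A (d 0 - 1) (d 1))
    convert hasSum_single (d 0 - 1) ?_ using 1
    · rcases Nat.eq_zero_or_pos (d 0) with h | h
      · simp [h]
      · rw [if_neg h.ne', if_pos (by omega)]
    · intro n hn
      rw [if_neg (by omega)]

/-- The coefficients of `log (1 + (-p) ^ (n + 1) * q ^ m)`, indexed by `t = d 0 / (n + 1)`. -/
theorem coeff_logS_one_add (n m : ℕ) (d : Fin 2 →₀ ℕ) :
    coeff d (logS (1 + (-Pv) ^ (n + 1) * Qv ^ m)) =
      if d 0 ≠ 0 ∧ n + 1 ∣ d 0 ∧ d 1 = d 0 / (n + 1) * m then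
        -(-1 : ℚ) ^ (d 0 + d 0 / (n + 1)) * ((d 0 / (n + 1) : ℕ) : ℚ)⁻¹ else 0 := by
  have hu : constantCoeff ((-Pv) ^ (n + 1) * Qv ^ m) = 0 := by simp [Pv]
  have h := WithPiTopology.hasSum_iff_hasSum_coeff.mp
    (summable_smul_pow_succ (fun n => (-1 : ℚ) ^ n * ((n + 1 : ℕ) : ℚ)⁻¹) hu).hasSum d
  have hlog : logS (1 + (-Pv) ^ (n + 1) * Qv ^ m) = ∑' t : ℕ,
      ((-1 : ℚ) ^ t * ((t + 1 : ℕ) : ℚ)⁻¹) • ((-Pv) ^ (n + 1) * Qv ^ m) ^ (t + 1) := by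
    rw [logS, add_sub_cancel_left]
  rw [hlog]
  refine h.unique ?_
  have hterm (t : ℕ) : coeff d (((-1 : ℚ) ^ t * ((t + 1 : ℕ) : ℚ)⁻¹) •
      ((-Pv) ^ (n + 1) * Qv ^ m) ^ (t + 1)) =
      if d 0 = (n + 1) * (t + 1) ∧ d 1 = m * (t + 1) then
        (-1 : ℚ) ^ t * ((t + 1 : ℕ) : ℚ)⁻¹ * (-1) ^ ((n + 1) * (t + 1)) else 0 := by
    have hpow : ((-Pv) ^ (n + 1) * Qv ^ m) ^ (t + 1) =
        (-1 : ℚ) ^ ((n + 1) * (t + 1)) • (Pv ^ ((n + 1) * (t + 1)) * Qv ^ (m * (t + 1))) := by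
      rw [mul_pow, ← pow_mul, ← pow_mul, neg_pow, smul_eq_C_mul]
      simp [mul_assoc]
    rw [hpow, smul_smul, coeff_smul, coeff_Pv_pow_mul_Qv_pow_s12, mul_ite, mul_one, mul_zero]
  simp only [hterm]
  convert hasSum_single (d 0 / (n + 1) - 1) ?_ using 1
  · by_cases hd : d 0 ≠ 0 ∧ n + 1 ∣ d 0
    · obtain ⟨h0, t, ht⟩ := hd
      obtain ⟨t, rfl⟩ : ∃ s, t = s + 1 :=
        Nat.exists_eq_succ_of_ne_zero (by rintro rfl; exact h0 (by simpa using ht))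
      have hdiv : d 0 / (n + 1) = t + 1 := by rw [ht, Nat.mul_div_cancel_left _ n.succ_pos]
      rw [hdiv, Nat.add_sub_cancel]
      refine if_congr ?_ ?_ rfl
      · rw [mul_comm m]
        exact ⟨fun h => ⟨ht, h.2.2⟩, fun h => ⟨h0, ⟨_, ht⟩, h.2⟩⟩
      · rw [← ht, pow_add, pow_succ]; ring
    · rw [if_neg fun h => hd ⟨h.1, h.2.1⟩, if_neg]
      rintro ⟨h, -⟩
      refine hd ⟨?_, _, h⟩
      rw [h]; positivity
  · intro t ht
    rw [if_neg]
    rintro ⟨h, -⟩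
    rw [h, Nat.mul_div_cancel_left _ n.succ_pos] at ht
    exact ht rfl

theorem exists_hasSum_smul_logS (c : ℕ → ℤ) :
    ∃ (G : ℕ → MvPowerSeries (Fin 2) ℚ) (R : MvPowerSeries (Fin 2) ℚ),
      (∀ n, HasSum (fun m =>
        (-c ((n + 1) * m)) • logS (1 + (-Pv) ^ (n + 1) * Qv ^ m)) (G n)) ∧ HasSum G R ∧
      ∀ d, coeff d R = if d 0 = 0 then 0 else ∑ t ∈ (Nat.gcd (d 1) (d 0)).divisors,
          (-1 : ℚ) ^ (d 0 + t) * (t : ℚ)⁻¹ * (c (d 1 * d 0 / t ^ 2) : ℚ) := by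
  let T (d : Fin 2 →₀ ℕ) (t : ℕ) : ℚ :=
    (-1 : ℚ) ^ (d 0 + t) * (t : ℚ)⁻¹ * (c (d 1 * d 0 / t ^ 2) : ℚ)
  refine ⟨fun n d => if d 0 ≠ 0 ∧ n + 1 ∣ d 0 ∧ d 0 / (n + 1) ∣ d 1 then T d (d 0 / (n + 1)) else 0,
    fun d => if d 0 = 0 then 0 else ∑ t ∈ (Nat.gcd (d 1) (d 0)).divisors, T d t,
    fun n => ?_, ?_, fun d => rfl⟩
  · refine WithPiTopology.hasSum_iff_hasSum_coeff.mpr fun d => ?_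
    change HasSum _ (if d 0 ≠ 0 ∧ n + 1 ∣ d 0 ∧ d 0 / (n + 1) ∣ d 1 then T d (d 0 / (n + 1)) else 0)
    simp only [map_zsmul, coeff_logS_one_add]
    by_cases hd : d 0 ≠ 0 ∧ n + 1 ∣ d 0
    · obtain ⟨h0, t, ht⟩ := hd
      have ht0 : 0 < t := Nat.pos_of_ne_zero (by rintro rfl; exact h0 (by simpa using ht))
      have hdvd : n + 1 ∣ d 0 := ⟨t, ht⟩
      have hdiv : d 0 / (n + 1) = t := by rw [ht, Nat.mul_div_cancel_left _ n.succ_pos]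
      simp only [hdiv, h0, hdvd, ne_eq, not_false_eq_true, true_and]
      convert hasSum_single (d 1 / t) ?_ using 1
      · by_cases htd : t ∣ d 1
        · obtain ⟨s, hs⟩ := htd
          have hsq : d 1 * d 0 / t ^ 2 = (n + 1) * s := by
            rw [hs, ht, show t * s * ((n + 1) * t) = (n + 1) * s * t ^ 2 by ring]
            exact Nat.mul_div_cancel _ (by positivity)
          have hdiv' : d 1 / t = s := by rw [hs, Nat.mul_div_cancel_left _ ht0]
          rw [if_pos ⟨s, hs⟩, hdiv', if_pos hs]
          simp only [T, hsq, zsmul_eq_mul]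
          push_cast
          ring
        · rw [if_neg htd, if_neg fun h => htd ⟨_, h⟩, smul_zero]
      · intro m hm
        rw [if_neg, smul_zero]
        intro h
        exact hm (by rw [h, Nat.mul_div_cancel_left _ ht0])
    · rw [if_neg fun h => hd ⟨h.1, h.2.1⟩]
      convert hasSum_zero using 2 with m
      rw [if_neg fun h => hd ⟨h.1, h.2.1⟩, smul_zero]
  · refine WithPiTopology.hasSum_iff_hasSum_coeff.mpr fun d => ?_
    change HasSum (fun n => if d 0 ≠ 0 ∧ n + 1 ∣ d 0 ∧ d 0 / (n + 1) ∣ d 1 then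
      T d (d 0 / (n + 1)) else 0)
      (if d 0 = 0 then 0 else ∑ t ∈ (Nat.gcd (d 1) (d 0)).divisors, T d t)
    by_cases h0 : d 0 = 0
    · simp [h0]
    · rw [if_neg h0]
      have hpos : 0 < d 0 := Nat.pos_of_ne_zero h0
      have hsum : ∑ t ∈ (Nat.gcd (d 1) (d 0)).divisors, T d t =
          ∑ n ∈ Finset.range (d 0), if d 0 ≠ 0 ∧ n + 1 ∣ d 0 ∧ d 0 / (n + 1) ∣ d 1 then
            T d (d 0 / (n + 1)) else 0 := by
        rw [← Finset.sum_filter]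
        refine Finset.sum_bij' (fun t _ => d 0 / t - 1) (fun n _ => d 0 / (n + 1)) ?_ ?_ ?_ ?_ ?_
        · intro t ht
          obtain ⟨htd, -⟩ := Nat.mem_divisors.mp ht
          obtain ⟨h1, h2⟩ := Nat.dvd_gcd_iff.mp htd
          have hq : 0 < d 0 / t := Nat.div_pos (Nat.le_of_dvd hpos h2) (Nat.pos_of_dvd_of_pos h2 hpos)
          have hq' : d 0 / t ≤ d 0 := Nat.div_le_self _ _
          rw [Finset.mem_filter, Finset.mem_range, Nat.sub_add_cancel hq, Nat.div_div_self h2 h0]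
          exact ⟨by omega, h0, Nat.div_dvd_of_dvd h2, h1⟩
        · intro n hn
          obtain ⟨-, -, h1, h2⟩ := Finset.mem_filter.mp hn
          exact Nat.mem_divisors.mpr ⟨Nat.dvd_gcd h2 (Nat.div_dvd_of_dvd h1),
            (Nat.gcd_pos_of_pos_right _ hpos).ne'⟩
        · intro t ht
          have h2 := (Nat.dvd_of_mem_divisors ht).trans (Nat.gcd_dvd_right _ _)
          have hq : 0 < d 0 / t := Nat.div_pos (Nat.le_of_dvd hpos h2) (Nat.pos_of_dvd_of_pos h2 hpos)
          simp only [Nat.sub_add_cancel hq, Nat.div_div_self h2 h0]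
        · intro n hn
          obtain ⟨-, -, h1, -⟩ := Finset.mem_filter.mp hn
          simp only [Nat.div_div_self h1 h0, Nat.add_sub_cancel]
        · intro t ht
          have h2 := (Nat.dvd_of_mem_divisors ht).trans (Nat.gcd_dvd_right _ _)
          have hq : 0 < d 0 / t := Nat.div_pos (Nat.le_of_dvd hpos h2) (Nat.pos_of_dvd_of_pos h2 hpos)
          simp only [Nat.sub_add_cancel hq, Nat.div_div_self h2 h0]
      rw [hsum]
      refine hasSum_sum_of_ne_finset_zero fun n hn => if_neg ?_
      rintro ⟨-, h1, -⟩
      exact hn (Finset.mem_range.mpr (Nat.le_of_dvd hpos h1))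

instance : T2Space (MvPowerSeries (Fin 2) ℚ) := WithPiTopology.instT2Space

/-- The `(α,β) = (1,0)` generalized Hecke computation: for any `c : ℕ → ℤ`, in `ℚ[[p,q]]`,
`log(∏_{n≥1}∏_{m≥0}(1+(-p)^n q^m)^{-c(nm)})
  = Σ_{n≥1}Σ_{m≥0}(Σ_{t | gcd(m,n)} (-1)^{n+t} t⁻¹ c(mn/t²)) p^n q^m`. -/
theorem log_alternating_hecke (c : ℕ → ℤ) :
    logS (∏' n : ℕ, ∏' m : ℕ, zpowF (1 + (-Pv) ^ (n + 1) * Qv ^ m) (-c ((n + 1) * m))) =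
      ∑' n : ℕ, ∑' m : ℕ,
        (∑ t ∈ (Nat.gcd m (n + 1)).divisors,
          (-1 : ℚ) ^ (n + 1 + t) * (t : ℚ)⁻¹ * (c (m * (n + 1) / t ^ 2) : ℚ)) •
          (Pv ^ (n + 1) * Qv ^ m) := by
  let f (n m : ℕ) : MvPowerSeries (Fin 2) ℚ :=
    zpowF (1 + (-Pv) ^ (n + 1) * Qv ^ m) (-c ((n + 1) * m))
  have hx (n m : ℕ) : constantCoeff (1 + (-Pv) ^ (n + 1) * Qv ^ m) = 1 := by simp [Pv]
  have horder (n m : ℕ) : ((n + 1 + m : ℕ) : ℕ∞) ≤ (f n m - 1).order := by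
    obtain ⟨y, hy⟩ := sub_one_dvd_zpowF_sub_one (hx n m) (-c ((n + 1) * m))
    rw [hy, add_sub_cancel_left]
    exact ((natCast_le_order_neg_Pv_pow_mul_Qv_pow (n + 1) m).trans le_self_add).trans le_order_mul
  have hinner (n : ℕ) : HasProd (f n) (∏' m, f n m) :=
    (multipliable_of_natCast_le_order_sub_one fun m =>
      le_trans (by exact_mod_cast Nat.le_add_left m (n + 1)) (horder n m)).hasProd
  have houter : HasProd (fun n => ∏' m, f n m) (∏' n, ∏' m, f n m) :=
    (multipliable_of_natCast_le_order_sub_one fun n =>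
      le_order_sub_one_of_hasProd (fun m =>
        le_trans (by exact_mod_cast (by omega : n ≤ n + 1 + m)) (horder n m)) (hinner n)).hasProd
  obtain ⟨G, R, hG, hR, hcoeff⟩ := exists_hasSum_smul_logS c
  have hlog : IsLog (∏' n, ∏' m, f n m) R :=
    IsLog.hasProd (fun n => IsLog.hasProd
      (fun m => (isLog_logS (hx n m)).zpowF _) (hinner n) (hG n)) houter hR
  obtain ⟨G', R', hG', hR', hcoeff'⟩ := exists_hasSum_smul_Pv_pow_mul_Qv_pow fun n m =>
    ∑ t ∈ (Nat.gcd m (n + 1)).divisors,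
      (-1 : ℚ) ^ (n + 1 + t) * (t : ℚ)⁻¹ * (c (m * (n + 1) / t ^ 2) : ℚ)
  rw [(isLog_logS hlog.constantCoeff_left).unique hlog]
  simp only [fun n => (hG' n).tsum_eq]
  rw [hR'.tsum_eq]
  ext d
  rw [hcoeff, hcoeff']
  rcases Nat.eq_zero_or_pos (d 0) with h | h
  · simp [h]
  · simp only [Nat.sub_add_cancel h]
end
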